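/- arXiv:1912.00545 — 5 statements merged into one kernel-verified Lean document; each statement's English description precedes it below -/
import Mathlib

section
/- For the area-preserving mean curvature flow, i.e., under the evolution law ∂_t x^t = v^t n^t + w^t t^t with normal velocity v^t = −κ^t + (1/L(t)) ∫₀¹ κ^t |∂_u x^t| du, one has d/dt L(t) = (1/L(t)) [ (∫₀¹ κ^t |∂_u x^t| du)² − L(t) ∫₀¹ (κ^t)² |∂_u x^t| du ] ≤ 0 (curve-shortening, by the Cauchy–Schwarz inequality) and d/dt A(t) = 0 (area preservation). -/
open Real

/-- Euclidean norm on the plane `ℝ × ℝ`. -/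
noncomputable def norm2 (p : ℝ × ℝ) : ℝ := Real.sqrt (p.1 ^ 2 + p.2 ^ 2)

/-- Rotation by `π/2`: `J(a,b) = (-b,a)`. -/
def Jrot (p : ℝ × ℝ) : ℝ × ℝ := (-p.2, p.1)

/-- Euclidean dot product on the plane `ℝ × ℝ`. -/
def dot (p q : ℝ × ℝ) : ℝ := p.1 * q.1 + p.2 * q.2

section PartialDerivatives

variable {E : Type*} [NormedAddCommGroup E] [NormedSpace ℝ E] {f : ℝ → ℝ → E}

theorem hasDerivAt_snd_of_differentiable (hf : Differentiable ℝ (Function.uncurry f)) (t u : ℝ) :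
    HasDerivAt (f t) (fderiv ℝ (Function.uncurry f) (t, u) (0, 1)) u := by
  have h : HasDerivAt (fun u' : ℝ => (t, u')) ((0 : ℝ), (1 : ℝ)) u :=
    (hasDerivAt_const u t).prodMk (hasDerivAt_id u)
  exact (hf (t, u)).hasFDerivAt.comp_hasDerivAt u h

theorem hasDerivAt_fst_of_differentiable (hf : Differentiable ℝ (Function.uncurry f)) (t u : ℝ) :
    HasDerivAt (fun s => f s u) (fderiv ℝ (Function.uncurry f) (t, u) (1, 0)) t := by
  have h : HasDerivAt (fun s : ℝ => (s, u)) ((1 : ℝ), (0 : ℝ)) t :=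
    (hasDerivAt_id t).prodMk (hasDerivAt_const t u)
  exact (hf (t, u)).hasFDerivAt.comp_hasDerivAt t h

theorem contDiff_deriv_snd (hf : ContDiff ℝ (⊤ : ℕ∞) (Function.uncurry f)) :
    ContDiff ℝ (⊤ : ℕ∞) (Function.uncurry fun t u => deriv (f t) u) := by
  have h : (Function.uncurry fun t u => deriv (f t) u)
      = fun p => fderiv ℝ (Function.uncurry f) p (0, 1) := by
    ext ⟨t, u⟩
    exact (hasDerivAt_snd_of_differentiable (hf.differentiable (by simp)) t u).deriv
  rw [h]
  exact (hf.fderiv_right (by simp)).clm_apply contDiff_const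

theorem contDiff_deriv_fst (hf : ContDiff ℝ (⊤ : ℕ∞) (Function.uncurry f)) :
    ContDiff ℝ (⊤ : ℕ∞) (Function.uncurry fun t u => deriv (fun s => f s u) t) := by
  have h : (Function.uncurry fun t u => deriv (fun s => f s u) t)
      = fun p => fderiv ℝ (Function.uncurry f) p (1, 0) := by
    ext ⟨t, u⟩
    exact (hasDerivAt_fst_of_differentiable (hf.differentiable (by simp)) t u).deriv
  rw [h]
  exact (hf.fderiv_right (by simp)).clm_apply contDiff_const

/-- Symmetry of mixed partial derivatives. -/
theorem deriv_deriv_comm (hf : ContDiff ℝ (⊤ : ℕ∞) (Function.uncurry f)) (t u : ℝ) :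
    deriv (fun s => deriv (f s) u) t = deriv (fun u' => deriv (fun s => f s u') t) u := by
  have hd : Differentiable ℝ (Function.uncurry f) := hf.differentiable (by simp)
  have hd' : Differentiable ℝ (fderiv ℝ (Function.uncurry f)) :=
    (hf.fderiv_right (m := (⊤ : ℕ∞)) (by simp)).differentiable (by simp)
  have hs : (fun s => deriv (f s) u) = fun s => fderiv ℝ (Function.uncurry f) (s, u) (0, 1) :=
    funext fun s => (hasDerivAt_snd_of_differentiable hd s u).deriv
  have hu : (fun u' => deriv (fun s => f s u') t)
      = fun u' => fderiv ℝ (Function.uncurry f) (t, u') (1, 0) :=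
    funext fun u' => (hasDerivAt_fst_of_differentiable hd t u').deriv
  have h₁ := (hasDerivAt_fst_of_differentiable
    (f := fun s u' => fderiv ℝ (Function.uncurry f) (s, u')) hd' t u).clm_apply
      (hasDerivAt_const t ((0 : ℝ), (1 : ℝ)))
  have h₂ := (hasDerivAt_snd_of_differentiable
    (f := fun s u' => fderiv ℝ (Function.uncurry f) (s, u')) hd' t u).clm_apply
      (hasDerivAt_const u ((1 : ℝ), (0 : ℝ)))
  rw [hs, hu, h₁.deriv, h₂.deriv]
  simpa [Function.uncurry_def] using
    (hf.contDiffAt (x := (t, u))).isSymmSndFDerivAt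
      (by simpa using WithTop.coe_le_coe.2 (le_top (a := (2 : ℕ∞)))) (1, 0) (0, 1)

/-- Differentiation under the integral sign for smooth integrands on a compact interval. -/
theorem hasDerivAt_intervalIntegral_of_contDiff
    (hf : ContDiff ℝ (⊤ : ℕ∞) (Function.uncurry f)) (a b t : ℝ) :
    HasDerivAt (fun s => ∫ u in a..b, f s u) (∫ u in a..b, deriv (fun s => f s u) t) t := by
  have hc : Continuous (Function.uncurry fun t u => deriv (fun s => f s u) t) :=
    (contDiff_deriv_fst hf).continuous
  obtain ⟨C, hC⟩ := ((isCompact_closedBall t 1).prod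
    (isCompact_uIcc (a := a) (b := b))).exists_bound_of_continuousOn hc.continuousOn
  refine (intervalIntegral.hasDerivAt_integral_of_dominated_loc_of_deriv_le
    (F' := fun t u => deriv (fun s => f s u) t) (bound := fun _ => C)
    (Metric.closedBall_mem_nhds t one_pos) ?_ ?_ ?_ ?_ ?_ ?_).2
  · exact .of_forall fun s => (hf.continuous.uncurry_left s).aestronglyMeasurable
  · exact (hf.continuous.uncurry_left t).intervalIntegrable _ _
  · exact (hc.uncurry_left t).aestronglyMeasurable
  · exact .of_forall fun u hu s hs => hC (s, u) ⟨hs, Set.uIoc_subset_uIcc hu⟩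
  · exact intervalIntegrable_const
  · exact .of_forall fun u _ s _ => (hasDerivAt_fst_of_differentiable
      (hf.differentiable (by simp)) s u).differentiableAt.hasDerivAt

end PartialDerivatives

theorem norm2_pos {p : ℝ × ℝ} (hp : p ≠ 0) : 0 < norm2 p := by
  refine Real.sqrt_pos.2 ?_
  by_contra! h
  exact hp (Prod.ext (by simp only [Prod.fst_zero]; nlinarith [sq_nonneg p.1, sq_nonneg p.2])
    (by simp only [Prod.snd_zero]; nlinarith [sq_nonneg p.1, sq_nonneg p.2]))

theorem norm2_sq (p : ℝ × ℝ) : norm2 p ^ 2 = p.1 ^ 2 + p.2 ^ 2 :=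
  Real.sq_sqrt (by positivity)

theorem contDiff_norm2_comp {E : Type*} [NormedAddCommGroup E] [NormedSpace ℝ E]
    {n : WithTop ℕ∞} {f : E → ℝ × ℝ} (hf : ContDiff ℝ n f) (h0 : ∀ p, f p ≠ 0) :
    ContDiff ℝ n fun p => norm2 (f p) :=
  ((hf.fst.pow 2).add (hf.snd.pow 2)).sqrt fun p => (Real.sqrt_pos.1 (norm2_pos (h0 p))).ne'

theorem HasDerivAt.prod_fst {f : ℝ → ℝ × ℝ} {f' : ℝ × ℝ} {t : ℝ} (hf : HasDerivAt f f' t) :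
    HasDerivAt (fun s => (f s).1) f'.1 t := by
  simpa using (HasFDerivAt.fst hf.hasFDerivAt).hasDerivAt

theorem HasDerivAt.prod_snd {f : ℝ → ℝ × ℝ} {f' : ℝ × ℝ} {t : ℝ} (hf : HasDerivAt f f' t) :
    HasDerivAt (fun s => (f s).2) f'.2 t := by
  simpa using (HasFDerivAt.snd hf.hasFDerivAt).hasDerivAt

theorem hasDerivAt_norm2 {f : ℝ → ℝ × ℝ} {f' : ℝ × ℝ} {t : ℝ} (hf : HasDerivAt f f' t)
    (h0 : f t ≠ 0) : HasDerivAt (fun s => norm2 (f s)) (dot (f t) f' / norm2 (f t)) t := by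
  have h := ((hf.prod_fst.pow 2).add (hf.prod_snd.pow 2)).sqrt (Real.sqrt_pos.1 (norm2_pos h0)).ne'
  refine h.congr_deriv ?_
  have := (norm2_pos h0).ne'
  simp only [dot, norm2] at this ⊢
  simp only [Pi.add_apply, Pi.pow_apply]
  field_simp
  simp
  ring

/-- Weighted Cauchy–Schwarz inequality against the constant function `1`. -/
theorem sq_integral_mul_le {k g : ℝ → ℝ} (hk : Continuous k) (hg : Continuous g)
    (hg0 : ∀ u, 0 ≤ g u) (hL : 0 < ∫ u in (0 : ℝ)..1, g u) :
    (∫ u in (0 : ℝ)..1, k u * g u) ^ 2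
      ≤ (∫ u in (0 : ℝ)..1, g u) * ∫ u in (0 : ℝ)..1, k u ^ 2 * g u := by
  set L := ∫ u in (0 : ℝ)..1, g u
  set K := ∫ u in (0 : ℝ)..1, k u * g u with hK
  set Q := ∫ u in (0 : ℝ)..1, k u ^ 2 * g u with hQ
  have h0 : 0 ≤ ∫ u in (0 : ℝ)..1, (L * k u - K) ^ 2 * g u :=
    intervalIntegral.integral_nonneg zero_le_one fun u _ => mul_nonneg (sq_nonneg _) (hg0 u)
  have h1 : ∫ u in (0 : ℝ)..1, (L * k u - K) ^ 2 * g u = L * (L * Q - K ^ 2) := by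
    have h2 : ∀ u, (L * k u - K) ^ 2 * g u
        = L ^ 2 * (k u ^ 2 * g u) - 2 * L * K * (k u * g u) + K ^ 2 * g u := fun u => by ring
    simp only [h2]
    rw [intervalIntegral.integral_add, intervalIntegral.integral_sub,
      intervalIntegral.integral_const_mul, intervalIntegral.integral_const_mul,
      intervalIntegral.integral_const_mul, ← hQ, ← hK]
    · ring
    all_goals exact Continuous.intervalIntegrable (by fun_prop) _ _
  rw [h1] at h0
  linarith [nonneg_of_mul_nonneg_right h0 hL]


/-- Area-preserving mean curvature flow
(`v = −κ + (∫₀¹ κ |∂ᵤ x| du)/L`): the length satisfies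
`L' = ((∫ κ |∂ᵤ x| du)² − L ∫ κ² |∂ᵤ x| du)/L ≤ 0` and the enclosed area satisfies
`A' = 0`. -/
theorem area_preserving_mcf
    (x : ℝ → ℝ → ℝ × ℝ) (v w κ : ℝ → ℝ → ℝ)
    (tang nrm : ℝ → ℝ → ℝ × ℝ)
    (hx : ContDiff ℝ (⊤ : ℕ∞) (Function.uncurry x))
    (hxper : ∀ t u, x t (u + 1) = x t u)
    (hreg : ∀ t u, deriv (x t) u ≠ 0)
    (hv : ContDiff ℝ (⊤ : ℕ∞) (Function.uncurry v))
    (hw : ContDiff ℝ (⊤ : ℕ∞) (Function.uncurry w))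
    (hvper : ∀ t u, v t (u + 1) = v t u)
    (hwper : ∀ t u, w t (u + 1) = w t u)
    (htang : ∀ t u, tang t u = (norm2 (deriv (x t) u))⁻¹ • deriv (x t) u)
    (hnrm : ∀ t u, nrm t u = -Jrot (tang t u))
    (hfrenet : ∀ t u, deriv (fun u' => tang t u') u
      = (-(κ t u) * norm2 (deriv (x t) u)) • nrm t u)
    (hevol : ∀ t u, HasDerivAt (fun s => x s u) (v t u • nrm t u + w t u • tang t u) t)
    (hL : ∀ t, 0 < ∫ u in (0:ℝ)..1, norm2 (deriv (x t) u))
    (hap : ∀ t u, v t u = -κ t u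
      + (∫ u' in (0:ℝ)..1, κ t u' * norm2 (deriv (x t) u'))
        / (∫ u' in (0:ℝ)..1, norm2 (deriv (x t) u')))
    (t : ℝ) :
    HasDerivAt (fun s => ∫ u in (0:ℝ)..1, norm2 (deriv (x s) u))
      (((∫ u in (0:ℝ)..1, κ t u * norm2 (deriv (x t) u)) ^ 2
          - (∫ u in (0:ℝ)..1, norm2 (deriv (x t) u))
            * ∫ u in (0:ℝ)..1, (κ t u) ^ 2 * norm2 (deriv (x t) u))
        / (∫ u in (0:ℝ)..1, norm2 (deriv (x t) u))) t
    ∧ ((∫ u in (0:ℝ)..1, κ t u * norm2 (deriv (x t) u)) ^ 2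
          - (∫ u in (0:ℝ)..1, norm2 (deriv (x t) u))
            * ∫ u in (0:ℝ)..1, (κ t u) ^ 2 * norm2 (deriv (x t) u))
        / (∫ u in (0:ℝ)..1, norm2 (deriv (x t) u)) ≤ 0
    ∧ HasDerivAt
        (fun s => (1 / 2) * ∫ u in (0:ℝ)..1, dot (x s u) (nrm s u) * norm2 (deriv (x s) u))
        0 t := by
  have hDx : ContDiff ℝ (⊤ : ℕ∞) (Function.uncurry fun s u => deriv (x s) u) :=
    contDiff_deriv_snd hx
  have hg : ContDiff ℝ (⊤ : ℕ∞) (Function.uncurry fun s u => norm2 (deriv (x s) u)) :=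
    contDiff_norm2_comp hDx fun p => hreg p.1 p.2
  have hgpos : ∀ s u, 0 < norm2 (deriv (x s) u) := fun s u => norm2_pos (hreg s u)
  have hgc : Continuous fun u => norm2 (deriv (x t) u) := hg.continuous.uncurry_left t
  have hDu : ∀ u, HasDerivAt (x t) (deriv (x t) u) u := fun u =>
    (hasDerivAt_snd_of_differentiable
      (hx.differentiable (by simp)) t u).differentiableAt.hasDerivAt
  have hvc : Continuous (v t) := hv.continuous.uncurry_left t
  have hκc : Continuous (κ t) := by
    have h : κ t = fun u => (∫ u' in (0:ℝ)..1, κ t u' * norm2 (deriv (x t) u'))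
        / (∫ u' in (0:ℝ)..1, norm2 (deriv (x t) u')) - v t u := by
      ext u; rw [hap t u]; ring
    rw [h]; fun_prop
  have hX : ∀ s u, deriv (x s) u = norm2 (deriv (x s) u) • tang s u := fun s u => by
    rw [htang, smul_inv_smul₀ (hgpos s u).ne']
  have hTT : ∀ u, (tang t u).1 ^ 2 + (tang t u).2 ^ 2 = 1 := fun u => by
    have h := norm2_sq (deriv (x t) u)
    have h0 := (hgpos t u).ne'
    simp only [htang, Prod.smul_fst, Prod.smul_snd, smul_eq_mul]
    field_simp
    exact h.symm
  have hT : ∀ u, HasDerivAt (tang t) ((-(κ t u) * norm2 (deriv (x t) u)) • nrm t u) u := fun u => by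
    rw [← hfrenet t u]
    have h : ContDiff ℝ (⊤ : ℕ∞) (Function.uncurry tang) := by
      have h' : Function.uncurry tang = fun p : ℝ × ℝ =>
          (norm2 (deriv (x p.1) p.2))⁻¹ • deriv (x p.1) p.2 := funext fun p => htang p.1 p.2
      rw [h']
      exact (hg.inv fun p => (hgpos p.1 p.2).ne').smul hDx
    exact (hasDerivAt_snd_of_differentiable
      (h.differentiable (by simp)) t u).differentiableAt.hasDerivAt
  have hN : ∀ u, HasDerivAt (nrm t) ((κ t u * norm2 (deriv (x t) u)) • tang t u) u := fun u => by
    have h := (hT u).prod_snd.prodMk (hT u).prod_fst.neg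
    refine (h.congr_deriv ?_).congr_of_eventuallyEq (.of_forall fun u' => ?_)
    · ext <;> simp [hnrm, Jrot]
    · simp [hnrm, Jrot]
  have hvu : ∀ u, HasDerivAt (v t) (deriv (v t) u) u := fun u =>
    (hasDerivAt_snd_of_differentiable
      (hv.differentiable (by simp)) t u).differentiableAt.hasDerivAt
  have hwu : ∀ u, HasDerivAt (w t) (deriv (w t) u) u := fun u =>
    (hasDerivAt_snd_of_differentiable
      (hw.differentiable (by simp)) t u).differentiableAt.hasDerivAt
  have hDt : ∀ u, deriv (fun s => x s u) t = v t u • nrm t u + w t u • tang t u := fun u =>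
    (hevol t u).deriv
  have hDtu : ∀ u, HasDerivAt (fun u => deriv (fun s => x s u) t)
      (deriv (fun s => deriv (x s) u) t) u := fun u => by
    rw [deriv_deriv_comm hx]
    exact (hasDerivAt_snd_of_differentiable
      ((contDiff_deriv_fst hx).differentiable (by simp)) t u).differentiableAt.hasDerivAt
  have hDut : ∀ u, HasDerivAt (fun s => deriv (x s) u) (deriv (fun s => deriv (x s) u) t) t :=
    fun u => (hasDerivAt_fst_of_differentiable
      (hDx.differentiable (by simp)) t u).differentiableAt.hasDerivAt
  have hmix : ∀ u, deriv (fun s => deriv (x s) u) t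
      = (v t u • (κ t u * norm2 (deriv (x t) u)) • tang t u + deriv (v t) u • nrm t u)
        + (w t u • (-(κ t u) * norm2 (deriv (x t) u)) • nrm t u + deriv (w t) u • tang t u) :=
    fun u => (hDtu u).unique <|
      (((hvu u).smul (hN u)).add ((hwu u).smul (hT u))).congr_of_eventuallyEq (.of_forall hDt)
  have hgt : ∀ u, deriv (fun s => norm2 (deriv (x s) u)) t
      = v t u * κ t u * norm2 (deriv (x t) u) + deriv (w t) u := fun u => by
    rw [(hasDerivAt_norm2 (hDut u) (hreg t u)).deriv, hmix, div_eq_iff (hgpos t u).ne']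
    have h1 := congrArg Prod.fst (hX t u)
    have h2 := congrArg Prod.snd (hX t u)
    have h3 := hTT u
    simp only [Prod.smul_fst, Prod.smul_snd, smul_eq_mul] at h1 h2
    simp only [dot, hnrm, Jrot, Prod.fst_add, Prod.snd_add, Prod.smul_fst, Prod.smul_snd,
      smul_eq_mul, Prod.fst_neg, Prod.snd_neg]
    rw [h1, h2]
    linear_combination (v t u * κ t u * norm2 (deriv (x t) u) + deriv (w t) u)
      * norm2 (deriv (x t) u) * h3
  have hwc : Continuous (deriv (w t)) := (contDiff_deriv_snd hw).continuous.uncurry_left t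
  have hw0 : ∫ u in (0:ℝ)..1, deriv (w t) u = 0 := by
    rw [intervalIntegral.integral_eq_sub_of_hasDerivAt (fun u _ => hwu u)
      (hwc.intervalIntegrable _ _), ← hwper t 0]
    simp
  have hLt := hL t
  have hCS := sq_integral_mul_le hκc hgc (fun u => (hgpos t u).le) hLt
  have hL' := hasDerivAt_intervalIntegral_of_contDiff hg 0 1 t
  have hA' : ∀ s, ∫ u in (0:ℝ)..1, dot (x s u) (nrm s u) * norm2 (deriv (x s) u)
      = ∫ u in (0:ℝ)..1, ((x s u).1 * (deriv (x s) u).2 - (x s u).2 * (deriv (x s) u).1) :=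
    fun s => intervalIntegral.integral_congr fun u _ => by
      have h1 := congrArg Prod.fst (hX s u)
      have h2 := congrArg Prod.snd (hX s u)
      simp only [Prod.smul_fst, Prod.smul_snd, smul_eq_mul] at h1 h2
      simp only [dot, hnrm, Jrot, Prod.fst_neg, Prod.snd_neg]
      linear_combination (x s u).2 * h1 - (x s u).1 * h2
  have hAsm : ContDiff ℝ (⊤ : ℕ∞) (Function.uncurry fun s u =>
      (x s u).1 * (deriv (x s) u).2 - (x s u).2 * (deriv (x s) u).1) :=
    (hx.fst.mul hDx.snd).sub (hx.snd.mul hDx.fst)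
  set L := ∫ u in (0:ℝ)..1, norm2 (deriv (x t) u) with hLdef
  set K := ∫ u in (0:ℝ)..1, κ t u * norm2 (deriv (x t) u) with hKdef
  refine ⟨hL'.congr_deriv ?_, div_nonpos_of_nonpos_of_nonneg (by linarith) hLt.le, ?_⟩
  · have h : ∀ u, deriv (fun s => norm2 (deriv (x s) u)) t
        = K / L * (κ t u * norm2 (deriv (x t) u)) - κ t u ^ 2 * norm2 (deriv (x t) u)
          + deriv (w t) u := fun u => by rw [hgt, hap]; ring
    simp only [h]
    rw [intervalIntegral.integral_add, intervalIntegral.integral_sub,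
      intervalIntegral.integral_const_mul, hw0, ← hKdef]
    · field_simp
      ring
    all_goals exact Continuous.intervalIntegrable (by fun_prop) _ _
  · simp only [hA']
    refine ((hasDerivAt_intervalIntegral_of_contDiff hAsm 0 1 t).const_mul (1 / 2)).congr_deriv ?_
    have hB : ∀ u, HasDerivAt (fun u => (x t u).1 * (deriv (fun s => x s u) t).2
        - (x t u).2 * (deriv (fun s => x s u) t).1) _ u := fun u =>
      ((hDu u).prod_fst.mul (hDtu u).prod_snd).sub ((hDu u).prod_snd.mul (hDtu u).prod_fst)
    have hxc : Continuous (x t) := hx.continuous.uncurry_left t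
    have hDxc : Continuous fun u => deriv (x t) u := hDx.continuous.uncurry_left t
    have hDtc : Continuous fun u => deriv (fun s => x s u) t :=
      (contDiff_deriv_fst hx).continuous.uncurry_left t
    have hDutc : Continuous fun u => deriv (fun s => deriv (x s) u) t :=
      (contDiff_deriv_fst hDx).continuous.uncurry_left t
    have hB0 := intervalIntegral.integral_eq_sub_of_hasDerivAt (a := 0) (b := 1)
      (fun u _ => hB u) (Continuous.intervalIntegrable (by fun_prop) _ _)
    have hper : ∀ s, x s 1 = x s 0 := fun s => by simpa using hxper s 0
    simp only [hper, sub_self] at hB0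
    have hAt : ∀ u, deriv (fun s => (x s u).1 * (deriv (x s) u).2
          - (x s u).2 * (deriv (x s) u).1) t
        = 2 * (K / L * norm2 (deriv (x t) u) - κ t u * norm2 (deriv (x t) u))
          + ((deriv (x t) u).1 * (deriv (fun s => x s u) t).2
              + (x t u).1 * (deriv (fun s => deriv (x s) u) t).2
            - ((deriv (x t) u).2 * (deriv (fun s => x s u) t).1
              + (x t u).2 * (deriv (fun s => deriv (x s) u) t).1)) := fun u => by
      have h := ((hevol t u).prod_fst.mul (hDut u).prod_snd).sub
        ((hevol t u).prod_snd.mul (hDut u).prod_fst)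
      refine h.deriv.trans ?_
      have h1 := congrArg Prod.fst (hX t u)
      have h2 := congrArg Prod.snd (hX t u)
      have h3 := hTT u
      have h4 := hap t u
      simp only [Prod.smul_fst, Prod.smul_snd, smul_eq_mul] at h1 h2
      simp only [hDt, hnrm, Jrot, Prod.fst_add, Prod.snd_add, Prod.smul_fst, Prod.smul_snd,
        smul_eq_mul, Prod.fst_neg, Prod.snd_neg]
      rw [h1, h2]
      linear_combination 2 * v t u * norm2 (deriv (x t) u) * h3
        + 2 * norm2 (deriv (x t) u) * h4
    simp only [hAt]
    rw [intervalIntegral.integral_add, hB0, intervalIntegral.integral_const_mul,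
      intervalIntegral.integral_sub, intervalIntegral.integral_const_mul, ← hKdef, ← hLdef]
    · field_simp
      ring
    all_goals exact Continuous.intervalIntegrable (by fun_prop) _ _
end

section
/- Under the semi-discrete polygonal evolution law ∂_t X_i = V_i N_i + W_i T_i with vertex normal velocities defined by averaging edge velocities, V_i = (v_i + v_{i+1})/(2 cos(φ_i/2)), the time derivative of the total length equals ∂_t L = Σ_{i=1}^N κ_i v_i r_i, where κ_i = (tan(φ_i/2) + tan(φ_{i−1}/2))/r_i is the discrete curvature. -/
open Real

/-- The derivative of the Euclidean length of a moving nonzero vector `p` is the component of its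
velocity along the unit vector `p / |p|`. -/
theorem hasDerivAt_norm2_s8 {p : ℝ → ℝ × ℝ} {p' : ℝ × ℝ} {t : ℝ}
    (hp : HasDerivAt p p' t) (h0 : p t ≠ 0) :
    HasDerivAt (fun s => norm2 (p s)) (dot ((norm2 (p t))⁻¹ • p t) p') t := by
  have h1 : HasDerivAt (fun s => (p s).1) p'.1 t := hp.fst
  have h2 : HasDerivAt (fun s => (p s).2) p'.2 t := hp.snd
  have hne : (p t).1 ^ 2 + (p t).2 ^ 2 ≠ 0 := by
    intro h
    have hx : (p t).1 = 0 := by nlinarith [sq_nonneg (p t).1, sq_nonneg (p t).2]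
    have hy : (p t).2 = 0 := by nlinarith [sq_nonneg (p t).1, sq_nonneg (p t).2]
    exact h0 (Prod.ext hx hy)
  have h := ((h1.pow 2).add (h2.pow 2)).sqrt hne
  refine h.congr_deriv ?_
  simp only [dot, norm2, Prod.smul_fst, Prod.smul_snd, smul_eq_mul, Pi.add_apply, Pi.pow_apply]
  field_simp
  ring

/-- Component, along the unit vector of angle `α`, of the velocity with coordinates `a`, `b` in the
frame whose normal and tangent are given by the angle `β`. -/
theorem dot_unit_frame (α β a b : ℝ) :
    dot (cos α, sin α) (a • -Jrot (cos β, sin β) + b • (cos β, sin β)) =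
      a * sin (β - α) + b * cos (β - α) := by
  simp only [dot, Jrot, Prod.neg_mk, Prod.smul_mk, Prod.mk_add_mk, smul_eq_mul, sin_sub, cos_sub]
  ring

theorem dot_sub_right (p q q' : ℝ × ℝ) : dot p (q - q') = dot p q - dot p q' := by
  simp only [dot, Prod.fst_sub, Prod.snd_sub]
  ring

/-- Under the semi-discrete polygonal evolution law with
`Vᵢ = (vᵢ + vᵢ₊₁)/(2 cos(φᵢ/2))`, the total length satisfies
`∂ₜ L = Σ κᵢ vᵢ rᵢ` with discrete curvature
`κᵢ = (tan(φᵢ/2) + tan(φᵢ₋₁/2))/rᵢ`. -/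
theorem polygon_length_derivative_curvature
    (N : ℕ) [NeZero N] (hN : 3 ≤ N)
    (X : ℝ → ZMod N → ℝ × ℝ)
    (r θ φ V W : ℝ → ZMod N → ℝ)
    (tv nv Tv Nv : ℝ → ZMod N → ℝ × ℝ)
    (hX : ∀ t i, X t i ≠ X t (i - 1))
    (hr : ∀ t i, r t i = norm2 (X t i - X t (i - 1)))
    (htv : ∀ t i, tv t i = (r t i)⁻¹ • (X t i - X t (i - 1)))
    (hnv : ∀ t i, nv t i = -Jrot (tv t i))
    (hθ : ∀ t i, tv t i = (cos (θ t i), sin (θ t i)))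
    (hφmem : ∀ t i, φ t i ∈ Set.Ioo (-π) π)
    (hφ : ∀ t i, tv t (i + 1) = (cos (θ t i + φ t i), sin (θ t i + φ t i)))
    (hTv : ∀ t i, Tv t i = (cos (θ t i + φ t i / 2), sin (θ t i + φ t i / 2)))
    (hNv : ∀ t i, Nv t i = -Jrot (Tv t i))
    (hevol : ∀ t i, HasDerivAt (fun s => X s i) (V t i • Nv t i + W t i • Tv t i) t)
    (κ v : ℝ → ZMod N → ℝ)
    (hκ : ∀ t i, κ t i = (tan (φ t i / 2) + tan (φ t (i - 1) / 2)) / r t i)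
    (hV : ∀ t i, V t i = (v t i + v t (i + 1)) / (2 * cos (φ t i / 2)))
    (t : ℝ) :
    HasDerivAt (fun s => ∑ i, r s i) (∑ i, κ t i * v t i * r t i) t := by
  have hcos : ∀ i, cos (φ t i / 2) ≠ 0 := fun i =>
    (cos_pos_of_mem_Ioo ⟨by linarith [(hφmem t i).1], by linarith [(hφmem t i).2]⟩).ne'
  have hr0 : ∀ i, r t i ≠ 0 := by
    intro i h
    have h1 := htv t i
    rw [h, inv_zero, zero_smul, hθ, Prod.mk_eq_zero] at h1
    simpa [h1.1, h1.2] using sin_sq_add_cos_sq (θ t i)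
  have hderiv : ∀ i, HasDerivAt (fun s => r s i)
      ((V t i * sin (φ t i / 2) + W t i * cos (φ t i / 2)) +
        (V t (i - 1) * sin (φ t (i - 1) / 2) - W t (i - 1) * cos (φ t (i - 1) / 2))) t := by
    intro i
    have h := hasDerivAt_norm2_s8 ((hevol t i).sub (hevol t (i - 1))) (sub_ne_zero.2 (hX t i))
    simp only [Pi.sub_apply, ← hr, ← htv] at h
    refine h.congr_deriv ?_
    have hprev : tv t i = (cos (θ t (i - 1) + φ t (i - 1)), sin (θ t (i - 1) + φ t (i - 1))) := by
      rw [← hφ, sub_add_cancel]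
    have hleft : θ t i + φ t i / 2 - θ t i = φ t i / 2 := by ring
    have hright : θ t (i - 1) + φ t (i - 1) / 2 - (θ t (i - 1) + φ t (i - 1)) =
        -(φ t (i - 1) / 2) := by ring
    rw [dot_sub_right]
    nth_rewrite 2 [hprev]
    rw [hθ, hNv, hNv, hTv, hTv, dot_unit_frame, dot_unit_frame, hleft, hright, sin_neg, cos_neg]
    ring
  have hshift : ∀ f : ZMod N → ℝ, ∑ i, f (i - 1) = ∑ i, f i := fun f =>
    (Equiv.subRight (1 : ZMod N)).sum_comp f
  refine (HasDerivAt.fun_sum fun i _ => hderiv i).congr_deriv ?_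
  have hsum : ∑ i, κ t i * v t i * r t i =
      ∑ i, tan (φ t i / 2) * v t i + ∑ i, tan (φ t (i - 1) / 2) * v t (i - 1 + 1) := by
    rw [← Finset.sum_add_distrib]
    refine Finset.sum_congr rfl fun i _ => ?_
    rw [hκ, sub_add_cancel]
    field_simp [hr0 i]
  rw [hsum, hshift fun i => tan (φ t i / 2) * v t (i + 1), Finset.sum_add_distrib,
    hshift fun i => V t i * sin (φ t i / 2) - W t i * cos (φ t i / 2),
    ← Finset.sum_add_distrib, ← Finset.sum_add_distrib]
  refine Finset.sum_congr rfl fun i _ => ?_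
  rw [hV, tan_eq_sin_div_cos]
  field_simp [hcos i]
  ring
end

section
/- Under the semi-discrete polygonal evolution law ∂_t X_i = V_i N_i + W_i T_i with V_i = (v_i + v_{i+1})/(2 cos(φ_i/2)), the time derivative of the enclosed area satisfies ∂_t A = Σ_{i=1}^N v_i r_i + Σ_{i=1}^N ( W_i sin(φ_i/2) − (v_{i+1} − v_i)/2 ) (r_{i+1} − r_i)/2. -/
open Real

theorem sum_comp_add_one {N : ℕ} [NeZero N] (f : ZMod N → ℝ) : ∑ i, f (i + 1) = ∑ i, f i :=
  Equiv.sum_comp (Equiv.addRight 1) f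

/-- The derivative of `(J p) · q` along differentiable plane curves `p`, `q`. -/
theorem HasDerivAt.dot_Jrot {p q : ℝ → ℝ × ℝ} {p' q' : ℝ × ℝ} {t : ℝ}
    (hp : HasDerivAt p p' t) (hq : HasDerivAt q q' t) :
    HasDerivAt (fun s => dot (Jrot (p s)) (q s)) (dot (Jrot p') (q t) + dot (Jrot (p t)) q') t := by
  have hp₁ : HasDerivAt (fun s => (p s).1) p'.1 t := hp.fst
  have hp₂ : HasDerivAt (fun s => (p s).2) p'.2 t := hp.snd
  have hq₁ : HasDerivAt (fun s => (q s).1) q'.1 t := hq.fst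
  have hq₂ : HasDerivAt (fun s => (q s).2) q'.2 t := hq.snd
  refine ((hp₂.fun_neg.fun_mul hq₁).fun_add (hp₁.fun_mul hq₂)).congr_deriv ?_
  simp only [dot, Jrot]
  ring

/-- First variation of the area of a closed polygon. -/
theorem hasDerivAt_polygon_area {N : ℕ} [NeZero N] {X : ℝ → ZMod N → ℝ × ℝ}
    {D : ZMod N → ℝ × ℝ} {t : ℝ} (hX : ∀ i, HasDerivAt (fun s => X s i) (D i) t) :
    HasDerivAt (fun s => (1 / 2) * ∑ i, dot (Jrot (X s (i - 1))) (X s i))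
      ((1 / 2) * ∑ i, dot (Jrot (D i)) (X t (i + 1) - X t (i - 1))) t := by
  refine ((HasDerivAt.fun_sum fun i _ => (hX (i - 1)).dot_Jrot (hX i)).const_mul
    (1 / 2 : ℝ)).congr_deriv ?_
  rw [Finset.sum_add_distrib,
    ← sum_comp_add_one fun i => dot (Jrot (D (i - 1))) (X t i), ← Finset.sum_add_distrib]
  congr 1
  refine Finset.sum_congr rfl fun i _ => ?_
  simp only [add_sub_cancel_right, dot, Jrot, Prod.fst_sub, Prod.snd_sub]
  ring

theorem norm2_ne_zero {p : ℝ × ℝ} (hp : p ≠ 0) : norm2 p ≠ 0 := by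
  intro h
  rw [norm2, Real.sqrt_eq_zero (by positivity)] at h
  exact hp (Prod.ext (by simp; nlinarith [sq_nonneg p.1, sq_nonneg p.2])
    (by simp; nlinarith [sq_nonneg p.1, sq_nonneg p.2]))

/-- Pairing of a vertex velocity, written in the frame at the angle bisecting the directions of
the adjacent edges, with the sum of these edges. -/
theorem dot_Jrot_velocity_edges (V W r₁ r₂ θ φ : ℝ) :
    dot (Jrot (V • -Jrot (cos (θ + φ / 2), sin (θ + φ / 2))
        + W • (cos (θ + φ / 2), sin (θ + φ / 2))))
      (r₂ • (cos (θ + φ), sin (θ + φ)) + r₁ • (cos θ, sin θ))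
      = V * cos (φ / 2) * (r₁ + r₂) + W * sin (φ / 2) * (r₂ - r₁) := by
  obtain ⟨β, rfl⟩ : ∃ β, θ = β - φ / 2 := ⟨θ + φ / 2, by ring⟩
  rw [show β - φ / 2 + φ = β + φ / 2 by ring, sub_add_cancel, cos_add, sin_add, cos_sub, sin_sub]
  simp only [dot, Jrot, Prod.smul_mk, Prod.neg_mk, Prod.mk_add_mk, smul_eq_mul]
  linear_combination (V * cos (φ / 2) * (r₁ + r₂) + W * sin (φ / 2) * (r₂ - r₁))
    * cos_sq_add_sin_sq β

/-- Under the semi-discrete polygonal evolution law with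
`Vᵢ = (vᵢ + vᵢ₊₁)/(2 cos(φᵢ/2))`, the enclosed area
`A = ½ Σ (J Xᵢ₋₁)·Xᵢ` satisfies
`∂ₜ A = Σ vᵢ rᵢ + Σ (Wᵢ sin(φᵢ/2) − (vᵢ₊₁ − vᵢ)/2)(rᵢ₊₁ − rᵢ)/2`. -/
theorem polygon_area_derivative
    (N : ℕ) [NeZero N] (hN : 3 ≤ N)
    (X : ℝ → ZMod N → ℝ × ℝ)
    (r θ φ V W : ℝ → ZMod N → ℝ)
    (tv nv Tv Nv : ℝ → ZMod N → ℝ × ℝ)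
    (hX : ∀ t i, X t i ≠ X t (i - 1))
    (hr : ∀ t i, r t i = norm2 (X t i - X t (i - 1)))
    (htv : ∀ t i, tv t i = (r t i)⁻¹ • (X t i - X t (i - 1)))
    (hnv : ∀ t i, nv t i = -Jrot (tv t i))
    (hθ : ∀ t i, tv t i = (cos (θ t i), sin (θ t i)))
    (hφmem : ∀ t i, φ t i ∈ Set.Ioo (-π) π)
    (hφ : ∀ t i, tv t (i + 1) = (cos (θ t i + φ t i), sin (θ t i + φ t i)))
    (hTv : ∀ t i, Tv t i = (cos (θ t i + φ t i / 2), sin (θ t i + φ t i / 2)))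
    (hNv : ∀ t i, Nv t i = -Jrot (Tv t i))
    (hevol : ∀ t i, HasDerivAt (fun s => X s i) (V t i • Nv t i + W t i • Tv t i) t)
    (v : ℝ → ZMod N → ℝ)
    (hV : ∀ t i, V t i = (v t i + v t (i + 1)) / (2 * cos (φ t i / 2)))
    (t : ℝ) :
    HasDerivAt (fun s => (1 / 2) * ∑ i, dot (Jrot (X s (i - 1))) (X s i))
      ((∑ i, v t i * r t i)
        + ∑ i, (W t i * sin (φ t i / 2) - (v t (i + 1) - v t i) / 2)
            * ((r t (i + 1) - r t i) / 2)) t := by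
  have hedge (i : ZMod N) : X t i - X t (i - 1) = r t i • tv t i := by
    rw [htv, smul_inv_smul₀ (hr t i ▸ norm2_ne_zero (sub_ne_zero.mpr (hX t i)))]
  have hpair (i : ZMod N) :
      dot (Jrot (V t i • Nv t i + W t i • Tv t i)) (X t (i + 1) - X t (i - 1))
        = (v t i + v t (i + 1)) / 2 * (r t i + r t (i + 1))
          + W t i * sin (φ t i / 2) * (r t (i + 1) - r t i) := by
    have hnext := hedge (i + 1)
    rw [add_sub_cancel_right] at hnext
    have hcos : cos (φ t i / 2) ≠ 0 :=
      (cos_pos_of_mem_Ioo ⟨by linarith [(hφmem t i).1], by linarith [(hφmem t i).2]⟩).ne'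
    rw [← sub_add_sub_cancel _ (X t i), hnext, hedge, hφ, hθ, hNv, hTv, dot_Jrot_velocity_edges, hV]
    field_simp
  refine (hasDerivAt_polygon_area (hevol t)).congr_deriv ?_
  have hshift : ∑ i, v t i * r t i
      = ∑ i, (v t i * r t i + v t (i + 1) * r t (i + 1)) / 2 := by
    rw [← Finset.sum_div, Finset.sum_add_distrib, sum_comp_add_one fun i => v t i * r t i]
    ring
  rw [hshift, ← Finset.sum_add_distrib, Finset.mul_sum]
  refine Finset.sum_congr rfl fun i _ => ?_
  rw [hpair]
  ring
end

section
/- For two closed polygons X̂ and X (indices mod N) with midpoint polygon X̄_i = (X_i + X̂_i)/2 and averaged difference quotients D_i = 2(X̄_i − X̄_{i−1})/(r_i + r̂_i), the difference of lengths satisfies the summation-by-parts identity L − L̂ = −Σ_{i=1}^N (D_{i+1} − D_i) · (X_i − X̂_i). -/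
open Real

theorem norm2_nonneg (p : ℝ × ℝ) : 0 ≤ norm2 p := Real.sqrt_nonneg _

theorem norm2_sub_norm2 (a b : ℝ × ℝ) :
    norm2 a - norm2 b = dot ((1 / (norm2 a + norm2 b)) • (a + b)) (a - b) := by
  have hdot : dot ((1 / (norm2 a + norm2 b)) • (a + b)) (a - b)
      = (norm2 a ^ 2 - norm2 b ^ 2) / (norm2 a + norm2 b) := by
    simp only [norm2_sq a, norm2_sq b, dot, Prod.smul_fst, Prod.smul_snd, Prod.fst_add,
      Prod.snd_add, Prod.fst_sub, Prod.snd_sub, smul_eq_mul]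
    ring
  rw [hdot]
  by_cases h : norm2 a + norm2 b = 0
  · rw [h, div_zero]
    linarith [norm2_nonneg a, norm2_nonneg b]
  · field_simp
    ring

/-- Summation by parts for periodic sequences in the plane. -/
theorem sum_dot_sub_eq_neg_sum_dot_sub {N : ℕ} [NeZero N] (D Y : ZMod N → ℝ × ℝ) :
    ∑ i, dot (D i) (Y i - Y (i - 1)) = -∑ i, dot (D (i + 1) - D i) (Y i) := by
  have hshift : ∑ i, dot (D (i + 1)) (Y i) = ∑ i, dot (D i) (Y (i - 1)) := by
    rw [← Equiv.sum_comp (Equiv.addRight (1 : ZMod N)) fun i => dot (D i) (Y (i - 1))]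
    simp
  have hleft (i : ZMod N) :
      dot (D i) (Y i - Y (i - 1)) = dot (D i) (Y i) - dot (D i) (Y (i - 1)) := by
    simp only [dot, Prod.fst_sub, Prod.snd_sub]
    ring
  have hright (i : ZMod N) :
      dot (D (i + 1) - D i) (Y i) = dot (D (i + 1)) (Y i) - dot (D i) (Y i) := by
    simp only [dot, Prod.fst_sub, Prod.snd_sub]
    ring
  simp only [hleft, hright, Finset.sum_sub_distrib, hshift]
  ring

/-- Summation-by-parts identity for two closed polygons:
`L − L̂ = −Σ (Dᵢ₊₁ − Dᵢ)·(Xᵢ − X̂ᵢ)` where `Dᵢ = 2(X̄ᵢ − X̄ᵢ₋₁)/(rᵢ + r̂ᵢ)`. -/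
theorem two_polygon_length_difference
    (N : ℕ) [NeZero N] (hN : 3 ≤ N)
    (X Xh : ZMod N → ℝ × ℝ)
    (hX : ∀ i, X i ≠ X (i - 1)) (hXh : ∀ i, Xh i ≠ Xh (i - 1))
    (r rh : ZMod N → ℝ)
    (hr : ∀ i, r i = norm2 (X i - X (i - 1)))
    (hrh : ∀ i, rh i = norm2 (Xh i - Xh (i - 1)))
    (Xb : ZMod N → ℝ × ℝ)
    (hXb : ∀ i, Xb i = (1 / 2 : ℝ) • (X i + Xh i))
    (D : ZMod N → ℝ × ℝ)
    (hD : ∀ i, D i = (2 / (r i + rh i)) • (Xb i - Xb (i - 1))) :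
    (∑ i, r i) - (∑ i, rh i) = -∑ i, dot (D (i + 1) - D i) (X i - Xh i) := by
  rw [← sum_dot_sub_eq_neg_sum_dot_sub D fun i => X i - Xh i, ← Finset.sum_sub_distrib]
  refine Finset.sum_congr rfl fun i _ => ?_
  have hDi : D i = (1 / (r i + rh i)) • ((X i - X (i - 1)) + (Xh i - Xh (i - 1))) := by
    rw [hD, hXb, hXb, ← smul_sub, smul_smul]
    congr 1
    · ring
    · abel
  rw [hDi, hr, hrh, norm2_sub_norm2, sub_sub_sub_comm]
end

section
/- Let an s-stage Runge–Kutta method with coefficients (a_{jk}) and weights (b_k) satisfying the symplecticity condition b_j a_{jk} + b_k a_{kj} = b_j b_k for all j,k be applied with step Δt > 0 to a vector field F on (ℝ²)^N: the stages Y_1,…,Y_s ∈ (ℝ²)^N satisfy Y_k = X + Δt Σ_{j=1}^s a_{kj} F(Y_j) and the update is X' = X + Δt Σ_{k=1}^s b_k F(Y_k). Then the discrete enclosed area A(X) = ½ Σ_{i=1}^N (J X_{i−1})·X_i satisfies A(X') − A(X) = (Δt/2) Σ_{k=1}^s b_k Σ_{i=1}^N ( J(Y_{k,i−1} − Y_{k,i+1})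 ) · f_i(Y_k), where Y_{k,i} ∈ ℝ² denotes the i-th vertex component of Y_k and f_i(Y) ∈ ℝ² the i-th component of F(Y); in particular the cross terms quadratic in Δt cancel. -/
open Real

/-- The bilinear form `(U, V) ↦ Σᵢ (J Uᵢ₋₁)·Vᵢ`, whose diagonal is twice the enclosed area. -/
def areaForm (N : ℕ) [NeZero N] : LinearMap.BilinForm ℝ (ZMod N → ℝ × ℝ) :=
  LinearMap.mk₂ ℝ (fun U V => ∑ i, dot (Jrot (U (i - 1))) (V i))
    (fun U U' V => by
      rw [← Finset.sum_add_distrib]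
      refine Finset.sum_congr rfl fun i _ => ?_
      simp [dot, Jrot]; ring)
    (fun c U V => by
      rw [Finset.smul_sum]
      refine Finset.sum_congr rfl fun i _ => ?_
      simp [dot, Jrot]; ring)
    (fun U V V' => by
      rw [← Finset.sum_add_distrib]
      refine Finset.sum_congr rfl fun i _ => ?_
      simp [dot, Jrot]; ring)
    (fun c U V => by
      rw [Finset.smul_sum]
      refine Finset.sum_congr rfl fun i _ => ?_
      simp [dot, Jrot]; ring)

theorem areaForm_apply (N : ℕ) [NeZero N] (U V : ZMod N → ℝ × ℝ) :
    areaForm N U V = ∑ i, dot (Jrot (U (i - 1))) (V i) := rfl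

theorem areaForm_add_swap (N : ℕ) [NeZero N] (U V : ZMod N → ℝ × ℝ) :
    areaForm N U V + areaForm N V U = ∑ i, dot (Jrot (U (i - 1) - U (i + 1))) (V i) := by
  have hshift : areaForm N V U = ∑ i, dot (Jrot (V i)) (U (i + 1)) := by
    rw [areaForm_apply, ← Equiv.sum_comp (Equiv.addRight (1 : ZMod N))]
    simp
  rw [hshift, areaForm_apply, ← Finset.sum_add_distrib]
  refine Finset.sum_congr rfl fun i _ => ?_
  simp only [dot, Jrot, Prod.fst_sub, Prod.snd_sub]
  ring

/-- A Runge–Kutta step satisfying the symplecticity condition changes a quadratic form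
`x ↦ B x x` by a combination of its derivatives at the stages only. -/
theorem bilinForm_rungeKutta_sub {E ι : Type*} [AddCommGroup E] [Module ℝ E] [Fintype ι]
    (B : LinearMap.BilinForm ℝ E) (a : ι → ι → ℝ) (b : ι → ℝ)
    (hsymp : ∀ j k, b j * a j k + b k * a k j = b j * b k)
    (h : ℝ) (x : E) (y f : ι → E) (hy : ∀ k, y k = x + h • ∑ j, a k j • f j) :
    B (x + h • ∑ k, b k • f k) (x + h • ∑ k, b k • f k) - B x x
      = h * ∑ k, b k * (B (y k) (f k) + B (f k) (y k)) := by
  have hcross : ∑ j, ∑ k, b j * (b k * B (f j) (f k))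
      = ∑ k, b k * (∑ j, a k j * B (f j) (f k) + ∑ j, a k j * B (f k) (f j)) := by
    simp only [mul_add, Finset.mul_sum, Finset.sum_add_distrib]
    rw [Finset.sum_comm (f := fun k j => b k * (a k j * B (f j) (f k))),
      ← Finset.sum_add_distrib]
    refine Finset.sum_congr rfl fun j _ => ?_
    rw [← Finset.sum_add_distrib]
    refine Finset.sum_congr rfl fun k _ => ?_
    linear_combination -B (f j) (f k) * hsymp j k
  have hquad : B (∑ k, b k • f k) (∑ k, b k • f k)
      = ∑ j, ∑ k, b j * (b k * B (f j) (f k)) := by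
    simp only [map_sum, map_smul, LinearMap.sum_apply, LinearMap.smul_apply, smul_eq_mul,
      Finset.mul_sum]
    rw [Finset.sum_comm]
    exact Finset.sum_congr rfl fun j _ => Finset.sum_congr rfl fun k _ => by ring
  have hstage : ∀ k, b k * (B (y k) (f k) + B (f k) (y k))
      = b k * B x (f k) + b k * B (f k) x
        + h * (b k * (∑ j, a k j * B (f j) (f k) + ∑ j, a k j * B (f k) (f j))) := by
    intro k
    rw [hy k]
    simp only [map_add, map_sum, map_smul, LinearMap.add_apply, LinearMap.sum_apply,
      LinearMap.smul_apply, smul_eq_mul]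
    ring
  have hright : B x (∑ k, b k • f k) = ∑ k, b k * B x (f k) := by simp
  have hleft : B (∑ k, b k • f k) x = ∑ k, b k * B (f k) x := by
    simp [LinearMap.sum_apply]
  simp only [hstage, Finset.sum_add_distrib, ← Finset.mul_sum]
  rw [← hcross, ← hquad, ← hright, ← hleft]
  simp only [map_add, map_smul, LinearMap.add_apply, LinearMap.smul_apply, smul_eq_mul]
  ring

/-- A canonical (symplectic) Runge–Kutta method applied to a polygonal vector field:
under the symplecticity condition `bⱼ aⱼₖ + bₖ aₖⱼ = bⱼ bₖ`, the discrete enclosed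
area `A(X) = ½ Σ (J Xᵢ₋₁)·Xᵢ` satisfies
`A(X') − A(X) = (Δt/2) Σₖ bₖ Σᵢ (J(Yₖ,ᵢ₋₁ − Yₖ,ᵢ₊₁))·fᵢ(Yₖ)`. -/
theorem symplectic_rk_area_difference
    (N : ℕ) [NeZero N] (hN : 3 ≤ N)
    (s : ℕ)
    (a : Fin s → Fin s → ℝ) (b : Fin s → ℝ)
    (hsymp : ∀ j k, b j * a j k + b k * a k j = b j * b k)
    (F : (ZMod N → ℝ × ℝ) → ZMod N → ℝ × ℝ)
    (Δt : ℝ) (hΔt : 0 < Δt)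
    (X X' : ZMod N → ℝ × ℝ)
    (Y : Fin s → ZMod N → ℝ × ℝ)
    (hY : ∀ k, Y k = X + Δt • ∑ j, a k j • F (Y j))
    (hX' : X' = X + Δt • ∑ k, b k • F (Y k)) :
    (1 / 2) * (∑ i, dot (Jrot (X' (i - 1))) (X' i))
      - (1 / 2) * (∑ i, dot (Jrot (X (i - 1))) (X i))
      = (Δt / 2) * ∑ k, b k * ∑ i, dot (Jrot (Y k (i - 1) - Y k (i + 1))) (F (Y k) i) := by
  simp only [← areaForm_add_swap, ← areaForm_apply]
  have hstep := bilinForm_rungeKutta_sub (areaForm N) a b hsymp Δt X Y (fun k => F (Y k)) hY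
  rw [← hX'] at hstep
  linear_combination (1 / 2) * hstep
end
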